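/- arXiv:2010.12100 — 6 statements merged into one kernel-verified Lean document; each statement's English description precedes it below -/
import Mathlib

section
/- Let X be a convex subset of ℝ^d, V : ℝ^d → ℝ^d continuous on X, and C a nonempty convex subset of X. Suppose x̂ ∈ C satisfies gap_C(x̂) = 0 (equivalently, ⟨V(x), x̂ − x⟩ ≤ 0 for all x ∈ C, with equality attained at x = x̂), and suppose C contains a neighborhood of x̂ in X, i.e. there is an open set U ⊆ ℝ^d with x̂ ∈ U and U ∩ X ⊆ C. Then x̂ is a solution of the variational inequality on X: ⟨V(x̂), x − x̂⟩ ≥ 0 for all x ∈ X. -/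
open RealInnerProductSpace

/-- If `V` is continuous on a convex set `X`, `C ⊆ X` is nonempty convex,
`xhat ∈ C` satisfies `gap_C(xhat) = 0` (equivalently `⟪V x, xhat - x⟫ ≤ 0` for all `x ∈ C`),
and `C` contains a neighborhood of `xhat` in `X`, then `xhat` solves the variational
inequality on `X`. -/
theorem stmt1 {d : ℕ} (X : Set (EuclideanSpace ℝ (Fin d))) (hX : Convex ℝ X)
    (V : EuclideanSpace ℝ (Fin d) → EuclideanSpace ℝ (Fin d))
    (hV : ContinuousOn V X)
    (C : Set (EuclideanSpace ℝ (Fin d))) (hCne : C.Nonempty) (hCX : C ⊆ X)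
    (hCconv : Convex ℝ C)
    (xhat : EuclideanSpace ℝ (Fin d)) (hxhatC : xhat ∈ C)
    (hgap : ∀ x ∈ C, ⟪V x, xhat - x⟫ ≤ 0)
    (U : Set (EuclideanSpace ℝ (Fin d))) (hUopen : IsOpen U) (hxhatU : xhat ∈ U)
    (hUXC : U ∩ X ⊆ C) :
    ∀ x ∈ X, 0 ≤ ⟪V xhat, x - xhat⟫ := by
  intro x hx
  have hmem : ∀ᶠ t : ℝ in nhdsWithin 0 (Set.Ioi 0), t ∈ Set.Ioo (0 : ℝ) 1 :=
    Ioo_mem_nhdsGT one_pos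
  have hpc : Continuous (fun t : ℝ => xhat + t • (x - xhat)) := by fun_prop
  have hp0 : Filter.Tendsto (fun t : ℝ => xhat + t • (x - xhat))
      (nhdsWithin 0 (Set.Ioi 0)) (nhds xhat) := by
    have h := (hpc.tendsto 0).mono_left (nhdsWithin_le_nhds (s := Set.Ioi (0 : ℝ)))
    simpa using h
  have hpX : ∀ᶠ t : ℝ in nhdsWithin 0 (Set.Ioi 0), xhat + t • (x - xhat) ∈ X := by
    filter_upwards [hmem] with t ht
    exact hX.add_smul_sub_mem (hCX hxhatC) hx ⟨ht.1.le, ht.2.le⟩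
  have hpU := hp0.eventually (hUopen.mem_nhds hxhatU)
  have hVt : Filter.Tendsto (fun t : ℝ => V (xhat + t • (x - xhat)))
      (nhdsWithin 0 (Set.Ioi 0)) (nhds (V xhat)) :=
    (hV xhat (hCX hxhatC)).tendsto.comp (tendsto_nhdsWithin_iff.2 ⟨hp0, hpX⟩)
  have hlim : Filter.Tendsto (fun t : ℝ => ⟪V (xhat + t • (x - xhat)), x - xhat⟫)
      (nhdsWithin 0 (Set.Ioi 0)) (nhds ⟪V xhat, x - xhat⟫) :=
    hVt.inner tendsto_const_nhds
  refine ge_of_tendsto hlim ?_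
  filter_upwards [hmem, hpX, hpU] with t ht h1 h2
  have h := hgap _ (hUXC ⟨h2, h1⟩)
  have e : xhat - (xhat + t • (x - xhat)) = -(t • (x - xhat)) := by abel
  rw [e, inner_neg_right, real_inner_smul_right] at h
  have ht0 : 0 < t := ht.1
  by_contra hneg
  have := mul_neg_of_pos_of_neg ht0 (not_le.1 hneg)
  linarith
end

section
/- Let X be a convex subset of ℝ^d, h : ℝ^d → ℝ a convex function, and g : X → ℝ^d a continuous map such that g(x) is a subgradient of h at every x ∈ X, i.e. h(z) ≥ h(x) + ⟨g(x), z − x⟩ for all x ∈ X and z ∈ ℝ^d. Then for all x, p ∈ X and every vector v that is a subgradient of h at x (i.e. h(z) ≥ h(x) + ⟨v, z − x⟩ for all z ∈ ℝ^d), one has ⟨g(x), x − p⟩ ≤ ⟨v, x − p⟩. -/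
open RealInnerProductSpace

/-- For a convex `h` with continuous subgradient selection `g` on a convex
set `X`, any subgradient `v` of `h` at `x ∈ X` satisfies
`⟪g x, x - p⟫ ≤ ⟪v, x - p⟫` for all `p ∈ X`. -/
theorem stmt2 {d : ℕ} (X : Set (EuclideanSpace ℝ (Fin d))) (hX : Convex ℝ X)
    (h : EuclideanSpace ℝ (Fin d) → ℝ) (hconv : ConvexOn ℝ Set.univ h)
    (g : EuclideanSpace ℝ (Fin d) → EuclideanSpace ℝ (Fin d))
    (hg : ContinuousOn g X)
    (hsel : ∀ x ∈ X, ∀ z, h x + ⟪g x, z - x⟫ ≤ h z)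
    (x p : EuclideanSpace ℝ (Fin d)) (hx : x ∈ X) (hp : p ∈ X)
    (v : EuclideanSpace ℝ (Fin d)) (hv : ∀ z, h x + ⟪v, z - x⟫ ≤ h z) :
    ⟪g x, x - p⟫ ≤ ⟪v, x - p⟫ := by
  have hy : ∀ t : ℝ, t ∈ Set.Ioc (0:ℝ) 1 → x + t • (p - x) ∈ X := fun t ht =>
    hX.add_smul_sub_mem hx hp ⟨ht.1.le, ht.2⟩
  have hev : ∀ᶠ t : ℝ in nhdsWithin 0 (Set.Ioi 0), t ∈ Set.Ioc (0:ℝ) 1 :=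
    Ioc_mem_nhdsGT one_pos
  have hlim : Filter.Tendsto (fun t : ℝ => x + t • (p - x))
      (nhdsWithin 0 (Set.Ioi 0)) (nhdsWithin x X) := by
    refine tendsto_nhdsWithin_iff.2 ⟨?_, hev.mono hy⟩
    have hc : Continuous (fun t : ℝ => x + t • (p - x)) := by fun_prop
    have h0 := hc.tendsto 0
    simp only [zero_smul, add_zero] at h0
    exact h0.mono_left nhdsWithin_le_nhds
  have hlim2 : Filter.Tendsto (fun t : ℝ => ⟪g (x + t • (p - x)), p - x⟫)
      (nhdsWithin 0 (Set.Ioi 0)) (nhds ⟪g x, p - x⟫) :=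
    (((hg x hx).tendsto).comp hlim).inner tendsto_const_nhds
  have key : ⟪v, p - x⟫ ≤ ⟪g x, p - x⟫ := by
    refine ge_of_tendsto hlim2 (hev.mono fun t ht => ?_)
    have h1 := hv (x + t • (p - x))
    have h2 := hsel _ (hy t ht) x
    have e1 : x + t • (p - x) - x = t • (p - x) := by abel
    have e2 : x - (x + t • (p - x)) = -(t • (p - x)) := by abel
    rw [e1, inner_smul_right] at h1
    rw [e2, inner_neg_right, inner_smul_right] at h2
    exact le_of_mul_le_mul_left (by linarith) ht.1
  rw [← neg_sub p x, inner_neg_right, inner_neg_right]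
  exact neg_le_neg key
end

section
/- Let X be a convex subset of ℝ^d, h : ℝ^d → ℝ convex, and g : X → ℝ^d a continuous map with g(x) a subgradient of h at every x ∈ X; define D(p, x) = h(p) − h(x) − ⟨g(x), p − x⟩. Let x ∈ X, y₁, y₂ ∈ ℝ^d, and x₁⁺, x₂⁺ ∈ X be such that g(x) + y₁ is a subgradient of h at x₁⁺ and g(x) + y₂ is a subgradient of h at x₂⁺ (i.e. x₁⁺ = prox_x(y₁), x₂⁺ = prox_x(y₂)). Then for every p ∈ X: D(p, x₂⁺) ≤ D(p, x) + ⟨y₂, x₁⁺ − p⟩ + ⟨y₂ − y₁, x₂⁺ − x₁⁺⟩ − D(x₂⁺, x₁⁺) − D(x₁⁺, x). -/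
open RealInnerProductSpace

/-- Along feasible directions the continuous selection dominates every subgradient. -/
theorem selection_dominates {d : ℕ} (X : Set (EuclideanSpace ℝ (Fin d))) (hX : Convex ℝ X)
    (h : EuclideanSpace ℝ (Fin d) → ℝ)
    (g : EuclideanSpace ℝ (Fin d) → EuclideanSpace ℝ (Fin d))
    (hg : ContinuousOn g X)
    (hsel : ∀ x ∈ X, ∀ z, h x + ⟪g x, z - x⟫ ≤ h z)
    (a q v : EuclideanSpace ℝ (Fin d)) (ha : a ∈ X) (hq : q ∈ X)
    (hv : ∀ z, h a + ⟪v, z - a⟫ ≤ h z) :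
    ⟪v, q - a⟫ ≤ ⟪g a, q - a⟫ := by
  have hmem : ∀ t ∈ Set.Icc (0 : ℝ) 1, a + t • (q - a) ∈ X := fun t ht =>
    hX.add_smul_sub_mem ha hq ht
  have hc : ContinuousOn (fun t : ℝ => ⟪g (a + t • (q - a)), q - a⟫) (Set.Icc 0 1) := by
    apply ContinuousOn.inner (𝕜 := ℝ) _ continuousOn_const
    exact hg.comp (by fun_prop) hmem
  have h0 := (hc 0 (by simp)).mono (Set.Ioo_subset_Icc_self)
  have ht : Filter.Tendsto (fun t : ℝ => ⟪g (a + t • (q - a)), q - a⟫)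
      (nhdsWithin 0 (Set.Ioo 0 1)) (nhds ⟪g a, q - a⟫) := by
    simpa [ContinuousWithinAt] using h0
  rw [nhdsWithin_Ioo_eq_nhdsGT (by norm_num : (0 : ℝ) < 1)] at ht
  refine ge_of_tendsto ht ?_
  filter_upwards [Ioo_mem_nhdsGT (by norm_num : (0 : ℝ) < 1)] with t ht1
  have h1 := hsel _ (hmem t ⟨ht1.1.le, ht1.2.le⟩) a
  have h2 := hv (a + t • (q - a))
  have e1 : a - (a + t • (q - a)) = -(t • (q - a)) := by abel
  have e2 : a + t • (q - a) - a = t • (q - a) := by abel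
  rw [e1, inner_neg_right, real_inner_smul_right] at h1
  rw [e2, real_inner_smul_right] at h2
  exact le_of_mul_le_mul_left (by linarith) ht1.1

/-- Two-prox-step inequality. With Bregman divergence
`D p x = h p - h x - ⟪g x, p - x⟫`, `x₁⁺ = prox_x(y₁)` and `x₂⁺ = prox_x(y₂)`
(characterized by `g x + yᵢ ∈ ∂h(xᵢ⁺)`), for every `p ∈ X`:
`D p x₂⁺ ≤ D p x + ⟪y₂, x₁⁺ - p⟫ + ⟪y₂ - y₁, x₂⁺ - x₁⁺⟫ - D x₂⁺ x₁⁺ - D x₁⁺ x`. -/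
theorem stmt4 {d : ℕ} (X : Set (EuclideanSpace ℝ (Fin d))) (hX : Convex ℝ X)
    (h : EuclideanSpace ℝ (Fin d) → ℝ) (hconv : ConvexOn ℝ Set.univ h)
    (g : EuclideanSpace ℝ (Fin d) → EuclideanSpace ℝ (Fin d))
    (hg : ContinuousOn g X)
    (hsel : ∀ x ∈ X, ∀ z, h x + ⟪g x, z - x⟫ ≤ h z)
    (D : EuclideanSpace ℝ (Fin d) → EuclideanSpace ℝ (Fin d) → ℝ)
    (hD : ∀ p x, D p x = h p - h x - ⟪g x, p - x⟫)
    (x x1plus x2plus : EuclideanSpace ℝ (Fin d))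
    (hx : x ∈ X) (hx1plus : x1plus ∈ X) (hx2plus : x2plus ∈ X)
    (y1 y2 : EuclideanSpace ℝ (Fin d))
    (hopt1 : ∀ z, h x1plus + ⟪g x + y1, z - x1plus⟫ ≤ h z)
    (hopt2 : ∀ z, h x2plus + ⟪g x + y2, z - x2plus⟫ ≤ h z) :
    ∀ p ∈ X, D p x2plus ≤ D p x + ⟪y2, x1plus - p⟫ + ⟪y2 - y1, x2plus - x1plus⟫
      - D x2plus x1plus - D x1plus x := by
  intro p hp
  have k1 := selection_dominates X hX h g hg hsel x2plus p _ hx2plus hp hopt2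
  have k2 := selection_dominates X hX h g hg hsel x1plus x2plus _ hx1plus hx2plus hopt1
  simp only [hD]
  simp only [inner_add_left, inner_sub_left, inner_sub_right] at k1 k2 ⊢
  linarith
end

section
/- Let X ⊆ ℝ^d be convex and let N : X × ℝ^d → ℝ be a family of local norms: for each x ∈ X, N(x, ·) is subadditive, absolutely homogeneous (N(x, λt) = |λ|N(x, t)), and satisfies N(x, t) ≥ ν‖t‖ for some ν > 0; let N*(x, v) = sup{⟨v, t⟩ : N(x, t) ≤ 1} be the dual local norm, and assume the duality pairing ⟨v, t⟩ ≤ N*(x, v)·N(x, t) holds for all x ∈ X, v, t ∈ ℝ^d. Let h : ℝ^d → ℝ be convex with a subgradient selection g : X → ℝ^d that is κ-strongly convex relative to N, i.e. h(z) ≥ h(x) + ⟨g(x), z − x⟩ + (κ/2)N(x, z − x)² for all x, z ∈ X with κ > 0, and set D(p, x) = h(p) − h(x) − ⟨g(x), p − x⟩. Let V : X → ℝ^d satisfy the metric bound N*(x, V(x)) ≤ G for all x ∈ X. If γ ∈ (0, 1] and x, x⁺ ∈ X satisfy the prox-optimality inequality ⟨g(x) − g(x⁺), x − x⁺⟩ ≤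 γ⟨V(x), x − x⁺⟩, then D(x, x⁺) + D(x⁺, x) ≤ 2G²γ²/κ; in particular both D(x, x⁺) ≤ 2G²γ²/κ and D(x⁺, x) ≤ 2G²γ²/κ. -/
open RealInnerProductSpace

/-- With a family of local norms `N`, dual norms `Nstar`, a Bregman–Finsler
function `h` (with subgradient selection `g`, `κ`-strongly convex relative to `N`) and a
metrically bounded `V` (`Nstar x (V x) ≤ G`), one prox step with `γ ∈ (0,1]` satisfies
`D x x⁺ + D x⁺ x ≤ 2G²γ²/κ`, hence each term is `≤ 2G²γ²/κ`. -/
theorem stmt6 {d : ℕ} (X : Set (EuclideanSpace ℝ (Fin d))) (hX : Convex ℝ X)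
    (N : EuclideanSpace ℝ (Fin d) → EuclideanSpace ℝ (Fin d) → ℝ)
    (ν : ℝ) (hν : 0 < ν)
    (hsub : ∀ x ∈ X, ∀ t t', N x (t + t') ≤ N x t + N x t')
    (hhom : ∀ x ∈ X, ∀ (c : ℝ) (t : EuclideanSpace ℝ (Fin d)), N x (c • t) = |c| * N x t)
    (hlow : ∀ x ∈ X, ∀ t, ν * ‖t‖ ≤ N x t)
    (Nstar : EuclideanSpace ℝ (Fin d) → EuclideanSpace ℝ (Fin d) → ℝ)
    (hNstar : ∀ x ∈ X, ∀ v, Nstar x v = sSup ((fun t => ⟪v, t⟫) '' {t | N x t ≤ 1}))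
    (hpair : ∀ x ∈ X, ∀ v t, ⟪v, t⟫ ≤ Nstar x v * N x t)
    (h : EuclideanSpace ℝ (Fin d) → ℝ) (hconv : ConvexOn ℝ Set.univ h)
    (g : EuclideanSpace ℝ (Fin d) → EuclideanSpace ℝ (Fin d))
    (hg : ContinuousOn g X)
    (κ : ℝ) (hκ : 0 < κ)
    (hstrong : ∀ x ∈ X, ∀ z ∈ X, h x + ⟪g x, z - x⟫ + (κ/2) * (N x (z - x))^2 ≤ h z)
    (D : EuclideanSpace ℝ (Fin d) → EuclideanSpace ℝ (Fin d) → ℝ)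
    (hD : ∀ p x, D p x = h p - h x - ⟪g x, p - x⟫)
    (V : EuclideanSpace ℝ (Fin d) → EuclideanSpace ℝ (Fin d))
    (G : ℝ) (hG : 0 < G)
    (hbound : ∀ x ∈ X, Nstar x (V x) ≤ G)
    (γ : ℝ) (hγ : γ ∈ Set.Ioc (0:ℝ) 1)
    (x xplus : EuclideanSpace ℝ (Fin d)) (hx : x ∈ X) (hxplus : xplus ∈ X)
    (hopt : ⟪g x - g xplus, x - xplus⟫ ≤ γ * ⟪V x, x - xplus⟫) :
    D x xplus + D xplus x ≤ 2 * G^2 * γ^2 / κ ∧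
      D x xplus ≤ 2 * G^2 * γ^2 / κ ∧ D xplus x ≤ 2 * G^2 * γ^2 / κ := by
  obtain ⟨hγ0, -⟩ := hγ
  have hn : N x (xplus - x) = N x (x - xplus) := by
    have := hhom x hx (-1) (x - xplus)
    simpa using this
  have hn0 : 0 ≤ N x (x - xplus) := le_trans (by positivity) (hlow x hx (x - xplus))
  have hS : D x xplus + D xplus x = ⟪g x - g xplus, x - xplus⟫ := by
    rw [hD, hD]
    simp only [inner_sub_left, inner_sub_right]
    ring
  have h1 := hstrong x hx xplus hxplus
  have h2 := hstrong xplus hxplus x hx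
  rw [hn] at h1
  have hD1 : κ / 2 * (N x (x - xplus))^2 ≤ D xplus x := by rw [hD]; linarith
  have hD2 : 0 ≤ D x xplus := by
    have : 0 ≤ κ / 2 * (N xplus (x - xplus))^2 := by positivity
    rw [hD]; linarith
  have hD3 : 0 ≤ D xplus x := le_trans (by positivity) hD1
  have hV : ⟪V x, x - xplus⟫ ≤ G * N x (x - xplus) :=
    (hpair x hx _ _).trans (mul_le_mul_of_nonneg_right (hbound x hx) hn0)
  have hS2 : D x xplus + D xplus x ≤ γ * (G * N x (x - xplus)) := by
    rw [hS]; exact hopt.trans (mul_le_mul_of_nonneg_left hV hγ0.le)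
  generalize N x (x - xplus) = n at *
  have hk : κ * n ≤ 2 * γ * G := by
    rcases hn0.eq_or_lt with h0 | h0
    · rw [← h0]; simp; positivity
    · refine le_of_mul_le_mul_right ?_ h0
      nlinarith
  have main : D x xplus + D xplus x ≤ 2 * G^2 * γ^2 / κ := by
    rw [le_div_iff₀ hκ]
    have e1 := mul_le_mul_of_nonneg_right hS2 hκ.le
    have e2 := mul_le_mul_of_nonneg_left hk (mul_pos hγ0 hG).le
    nlinarith
  exact ⟨main, by linarith, by linarith⟩
end

section
/- Let d ≥ 1 and let x, x' ∈ (0, 1]^d (all coordinates in (0,1]). Then Σ_{i=1}^{d} x_i·|1/x'_i − 1/x_i| ≤ d · max_{1≤i≤d} |x'_i − x_i|/x'_i. In other words, the vector field V(x) = (−1/x_1, …, −1/x_d) on (0,1]^d is metrically smooth with modulus L = d relative to the Finsler metric ‖t‖_x = max_i |t_i|/x_i: ‖V(x') − V(x)‖_{x,*} ≤ d·‖x' − x‖_{x'} for all x, x' ∈ (0,1]^d. -/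
/-- Metric smoothness of `V(x) = (−1/x₁, …, −1/x_d)` on `(0,1]^d` with
modulus `L = d` relative to the Finsler metric `‖t‖_x = maxᵢ |tᵢ|/xᵢ`:
`Σᵢ xᵢ·|1/x'ᵢ − 1/xᵢ| ≤ d · maxᵢ |x'ᵢ − xᵢ|/x'ᵢ`. -/
theorem stmt18 (d : ℕ) (hd : 0 < d) (x x' : Fin d → ℝ)
    (hx : ∀ i, x i ∈ Set.Ioc (0:ℝ) 1) (hx' : ∀ i, x' i ∈ Set.Ioc (0:ℝ) 1) :
    ∑ i, x i * |1 / x' i - 1 / x i| ≤ d * ⨆ i, |x' i - x i| / x' i := by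
  have key : ∀ i, x i * |1 / x' i - 1 / x i| = |x' i - x i| / x' i := by
    intro i
    have h1 : 0 < x i := (hx i).1
    have h2 : 0 < x' i := (hx' i).1
    have h3 : 1 / x' i - 1 / x i = (x i - x' i) / (x' i * x i) := by
      field_simp
    rw [h3, abs_div, abs_of_pos (mul_pos h2 h1), abs_sub_comm (x i)]
    field_simp
  calc ∑ i, x i * |1 / x' i - 1 / x i|
      ≤ ∑ _i : Fin d, ⨆ i, |x' i - x i| / x' i := by
        refine Finset.sum_le_sum fun i _ => ?_
        rw [key i]
        exact le_ciSup (f := fun i => |x' i - x i| / x' i) (Set.finite_range _).bddAbove i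
    _ = d * ⨆ i, |x' i - x i| / x' i := by
        simp
end

section
/- Let d ≥ 1 and let x, x' ∈ (0, 1]^d (all coordinates in (0,1]). Then Σ_{i=1}^{d} (1/x'_i − 1/x_i + (x'_i − x_i)/x_i²) = Σ_{i=1}^{d} (x'_i − x_i)²/(x_i²·x'_i) ≥ (max_{1≤i≤d} |x'_i − x_i|/x_i)². In other words, the function h(x) = Σ_{i=1}^{d} 1/x_i with gradient ∇h(x) = (−1/x_1², …, −1/x_d²) satisfies the strong-convexity bound D_h(x', x) ≥ ‖x' − x‖_x², i.e. h is 1-strongly convex (with 2 in place of the usual factor κ/2 = 1/2 absorbed) relative to the local norm ‖t‖_x = max_i |t_i|/x_i on (0,1]^d. -/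
/-- Strong convexity of `h(x) = Σᵢ 1/xᵢ` relative to the local norm
`‖t‖_x = maxᵢ |tᵢ|/xᵢ` on `(0,1]^d`: the Bregman divergence satisfies
`Σᵢ (1/x'ᵢ − 1/xᵢ + (x'ᵢ − xᵢ)/xᵢ²) = Σᵢ (x'ᵢ − xᵢ)²/(xᵢ²·x'ᵢ) ≥ (maxᵢ |x'ᵢ − xᵢ|/xᵢ)²`. -/
theorem stmt19 (d : ℕ) (hd : 0 < d) (x x' : Fin d → ℝ)
    (hx : ∀ i, x i ∈ Set.Ioc (0:ℝ) 1) (hx' : ∀ i, x' i ∈ Set.Ioc (0:ℝ) 1) :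
    (∑ i, (1 / x' i - 1 / x i + (x' i - x i) / (x i)^2)
        = ∑ i, (x' i - x i)^2 / ((x i)^2 * x' i)) ∧
      (⨆ i, |x' i - x i| / x i)^2 ≤ ∑ i, (x' i - x i)^2 / ((x i)^2 * x' i) := by
  constructor
  · refine Finset.sum_congr rfl fun i _ => ?_
    have h1 := (hx i).1.ne'
    have h2 := (hx' i).1.ne'
    field_simp
    ring
  · have : Nonempty (Fin d) := ⟨⟨0, hd⟩⟩
    obtain ⟨j, hj⟩ := exists_eq_ciSup_of_finite (f := fun i => |x' i - x i| / x i)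
    rw [← hj]
    have h1 := (hx j).1
    have h2 := (hx' j).1
    have h3 := (hx' j).2
    have hterm : (|x' j - x j| / x j)^2 ≤ (x' j - x j)^2 / ((x j)^2 * x' j) := by
      rw [div_pow, sq_abs]
      apply div_le_div_of_nonneg_left (sq_nonneg _) (by positivity)
      exact mul_le_of_le_one_right (sq_nonneg _) h3
    refine hterm.trans ?_
    refine Finset.single_le_sum (f := fun i => (x' i - x i)^2 / ((x i)^2 * x' i))
      (fun i _ => ?_) (Finset.mem_univ j)
    have h4 := (hx' i).1
    positivity
end
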